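/- Let n ≥ 1 and m ≥ 2 be integers and set p = 2m + n − 3 and q = m + n − 2. There is no twice differentiable function f : ℝ → ℝ such that f'(r) > 0 for all r > 0, f(r) → ∞ as r → ∞, and for every r > 0 both (n+m−1)·f''(r) + (m−1)·f'(r)/r > 0 and f''(r) + p·f'(r)/r − q·(f'(r))² > 0. -/

import Mathlib

/-- Variant of Theorem 2: for integers `n ≥ 1`, `m ≥ 2`, with `p = 2m+n-3`, `q = m+n-2`,
there is no twice differentiable `f : ℝ → ℝ` with `f' > 0` on `(0,∞)`, `f r → ∞` as
`r → ∞`, satisfying `(n+m-1) f'' r + (m-1) f' r / r > 0` and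
`f'' r + p f' r / r - q (f' r)^2 > 0` for all `r > 0`. -/
theorem no_monotone_solution (n m : ℕ) (hn : 1 ≤ n) (hm : 2 ≤ m) :
    ¬ ∃ f : ℝ → ℝ,
      (∀ r : ℝ, DifferentiableAt ℝ f r) ∧
      (∀ r : ℝ, DifferentiableAt ℝ (deriv f) r) ∧
      (∀ r : ℝ, 0 < r → 0 < deriv f r) ∧
      Filter.Tendsto f Filter.atTop Filter.atTop ∧
      ∀ r : ℝ, 0 < r →
        0 < ((n : ℝ) + m - 1) * deriv (deriv f) r + ((m : ℝ) - 1) * deriv f r / r ∧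
        0 < deriv (deriv f) r + (2 * (m : ℝ) + n - 3) * deriv f r / r
            - ((m : ℝ) + n - 2) * (deriv f r) ^ 2 := by
  rintro ⟨f, -, hd, hpos, -, h⟩
  set g := deriv f with hg
  have hn' : (1 : ℝ) ≤ n := by exact_mod_cast hn
  have hm' : (2 : ℝ) ≤ m := by exact_mod_cast hm
  -- `A log g + B log r` is monotone on `[1, ∞)`
  have hL : MonotoneOn (fun r => ((n : ℝ) + m - 1) * Real.log (g r) + ((m : ℝ) - 1) * Real.log r)
      (Set.Ici 1) := by
    have hder : ∀ r : ℝ, 0 < r → HasDerivAt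
        (fun r => ((n : ℝ) + m - 1) * Real.log (g r) + ((m : ℝ) - 1) * Real.log r)
        (((n : ℝ) + m - 1) * (deriv g r / g r) + ((m : ℝ) - 1) * r⁻¹) r := by
      intro r hr
      exact (((hd r).hasDerivAt.log (hpos r hr).ne').const_mul _).add
        ((Real.hasDerivAt_log hr.ne').const_mul _)
    apply monotoneOn_of_deriv_nonneg (convex_Ici 1)
    · intro r hr
      exact (hder r (by linarith [Set.mem_Ici.1 hr])).continuousAt.continuousWithinAt
    · intro r hr
      rw [interior_Ici] at hr
      exact (hder r (by linarith [Set.mem_Ioi.1 hr])).differentiableAt.differentiableWithinAt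
    · intro r hr
      rw [interior_Ici] at hr
      have hr0 : 0 < r := by linarith [Set.mem_Ioi.1 hr]
      rw [(hder r hr0).deriv]
      have h1 := (h r hr0).1
      have hgr := hpos r hr0
      have : ((n : ℝ) + m - 1) * (deriv g r / g r) + ((m : ℝ) - 1) * r⁻¹
          = (((n : ℝ) + m - 1) * deriv g r + ((m : ℝ) - 1) * g r / r) / g r := by
        field_simp
      rw [this]
      exact (div_pos h1 hgr).le
  -- hence `r g r` is eventually large
  obtain ⟨R, hR1, hR⟩ : ∃ R : ℝ, 1 ≤ R ∧ ∀ r, R ≤ r → 2 * (2 * (m : ℝ) + n - 4) ≤ r * g r := by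
    set A : ℝ := (n : ℝ) + m - 1 with hA
    set c : ℝ := A * Real.log (g 1) + ((m : ℝ) - 1) * Real.log 1 with hc
    have hP : 0 < 2 * (2 * (m : ℝ) + n - 4) := by linarith
    have hA0 : 0 < A := by linarith
    obtain ⟨R, hR⟩ := (Filter.eventually_atTop.1
      (Real.tendsto_log_atTop.eventually_ge_atTop
        ((A * Real.log (2 * (2 * (m : ℝ) + n - 4)) - c) / n)))
    refine ⟨max R 1, le_max_right _ _, fun r hr => ?_⟩
    have hr1 : 1 ≤ r := (le_max_right _ _).trans hr
    have hr0 : 0 < r := by linarith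
    have h1 := hR r ((le_max_left _ _).trans hr)
    rw [div_le_iff₀ (by linarith)] at h1
    have h2 : c ≤ A * Real.log (g r) + ((m : ℝ) - 1) * Real.log r :=
      hL (Set.mem_Ici.2 le_rfl) (Set.mem_Ici.2 hr1) hr1
    rw [← Real.log_le_log_iff hP (mul_pos hr0 (hpos r hr0)),
      Real.log_mul hr0.ne' (hpos r hr0).ne']
    refine le_of_mul_le_mul_left ?_ hA0
    have : A * (Real.log r + Real.log (g r)) = Real.log r * n
        + (A * Real.log (g r) + ((m : ℝ) - 1) * Real.log r) := by rw [hA]; ring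
    linarith
  -- `1 / (r g r) + log r / 2` is antitone
  have hH : AntitoneOn (fun r => (r * g r)⁻¹ + (1 / 2) * Real.log r) (Set.Ici R) := by
    have hder : ∀ r : ℝ, 0 < r → HasDerivAt (fun r => (r * g r)⁻¹ + (1 / 2) * Real.log r)
        (-(1 * g r + r * deriv g r) / (r * g r) ^ 2 + (1 / 2) * r⁻¹) r := by
      intro r hr
      exact (((hasDerivAt_id r).mul (hd r).hasDerivAt).inv (mul_pos hr (hpos r hr)).ne').add
        ((Real.hasDerivAt_log hr.ne').const_mul _)
    apply antitoneOn_of_deriv_nonpos (convex_Ici R)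
    · intro r hr
      exact (hder r (by linarith [Set.mem_Ici.1 hr])).continuousAt.continuousWithinAt
    · intro r hr
      rw [interior_Ici] at hr
      exact (hder r (by linarith [Set.mem_Ioi.1 hr])).differentiableAt.differentiableWithinAt
    · intro r hr
      rw [interior_Ici] at hr
      have hrR : R ≤ r := le_of_lt hr
      have hr0 : 0 < r := by linarith
      rw [(hder r hr0).deriv]
      have h2 := (h r hr0).2
      have hgr := hpos r hr0
      have hv := hR r hrR
      have hv0 : 0 < r * g r := mul_pos hr0 hgr
      have h3 : 0 < r ^ 2 * deriv g r + (2 * (m : ℝ) + n - 3) * (r * g r)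
          - ((m : ℝ) + n - 2) * (r * g r) ^ 2 := by
        have h4 := mul_pos (pow_pos hr0 2) h2
        have : r ^ 2 * (deriv g r + (2 * (m : ℝ) + n - 3) * g r / r
            - ((m : ℝ) + n - 2) * (g r) ^ 2) = r ^ 2 * deriv g r + (2 * (m : ℝ) + n - 3) * (r * g r)
          - ((m : ℝ) + n - 2) * (r * g r) ^ 2 := by
          field_simp
        rwa [this] at h4
      have h5 : (r * g r) ^ 2 ≤ ((m : ℝ) + n - 2) * (r * g r) ^ 2 :=
        le_mul_of_one_le_left (by positivity) (by linarith)
      have h6 := mul_le_mul_of_nonneg_right hv hv0.le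
      have : -(1 * g r + r * deriv g r) / (r * g r) ^ 2 + (1 / 2) * r⁻¹
          = -(r * g r + r ^ 2 * deriv g r - (r * g r) ^ 2 / 2) / (r * (r * g r) ^ 2) := by
        field_simp
        ring
      rw [this]
      apply div_nonpos_of_nonpos_of_nonneg _ (by positivity)
      nlinarith
  obtain ⟨S, hS⟩ := (Filter.eventually_atTop.1
      (Real.tendsto_log_atTop.eventually_ge_atTop
        (2 * ((R * g R)⁻¹ + (1 / 2) * Real.log R))))
  have hmR : R ≤ max R S := le_max_left _ _
  have h1 := hS (max R S) (le_max_right _ _)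
  have h2 := hH (Set.mem_Ici.2 le_rfl) (Set.mem_Ici.2 hmR) hmR
  have hm0 : 0 < max R S := by linarith
  have h3 := inv_pos.2 (mul_pos hm0 (hpos _ hm0))
  simp only at h2
  linarith
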